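/- Assuming the continuum hypothesis, there is an undetermined Maker-Breaker game on a countably infinite board: there exists a family 𝒲 of subsets of ℕ such that in the Maker-Breaker game on ℕ with winning sets 𝒲, no valid Maker strategy σ guarantees that in every play following σ Maker's claimed set contains some member of 𝒲, and no valid Breaker strategy τ guarantees that in every play following τ Maker's claimed set contains no member of 𝒲. -/

import Mathlib

/-- The history M 0, B 0, …, M (n-1), B (n-1) seen by Maker before her n-th move. -/
def histM (M B : ℕ → ℕ) : ℕ → List ℕ
  | 0 => []
  | n + 1 => histM M B n ++ [M n, B n]

/-- The history M 0, B 0, …, M n seen by Breaker before his n-th move. -/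
def histB (M B : ℕ → ℕ) (n : ℕ) : List ℕ :=
  histM M B n ++ [M n]

/-- A play of the game: all the moves M 0, B 0, M 1, B 1, … are pairwise distinct. -/
def IsPlay (M B : ℕ → ℕ) : Prop :=
  Function.Injective (fun n => if n % 2 = 0 then M (n / 2) else B (n / 2))

/-- A strategy is valid if it never names an already claimed element. -/
def ValidStrat (σ : List ℕ → ℕ) : Prop :=
  ∀ h, σ h ∉ h

/-- The play (M, B) follows the Maker strategy σ. -/
def FollowsMaker (σ : List ℕ → ℕ) (M B : ℕ → ℕ) : Prop :=
  ∀ n, M n = σ (histM M B n)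

/-- The play (M, B) follows the Breaker strategy τ. -/
def FollowsBreaker (τ : List ℕ → ℕ) (M B : ℕ → ℕ) : Prop :=
  ∀ n, B n = τ (histB M B n)

def runH (σ τ : List ℕ → ℕ) : ℕ → List ℕ
  | 0 => []
  | n + 1 => runH σ τ n ++ [σ (runH σ τ n), τ (runH σ τ n ++ [σ (runH σ τ n)])]

lemma length_histM (M B : ℕ → ℕ) (n : ℕ) : (histM M B n).length = 2 * n := by
  induction n with
  | zero => rfl
  | succ n ih => simp [histM, ih]; omega

lemma mem_histM (M B : ℕ → ℕ) (n : ℕ) : ∀ i < 2 * n,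
    (if i % 2 = 0 then M (i / 2) else B (i / 2)) ∈ histM M B n := by
  induction n with
  | zero => intro i hi; omega
  | succ n ih =>
    intro i hi
    simp only [histM, List.mem_append, List.mem_cons]
    by_cases h : i < 2 * n
    · exact Or.inl (ih i h)
    · right
      have h2 : i / 2 = n := by omega
      rw [h2]
      split_ifs <;> simp

lemma exists_play (σ τ : List ℕ → ℕ) (hσ : ValidStrat σ) (hτ : ValidStrat τ) :
    ∃ M B : ℕ → ℕ, IsPlay M B ∧ FollowsMaker σ M B ∧ FollowsBreaker τ M B := by
  let M : ℕ → ℕ := fun n => σ (runH σ τ n)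
  let B : ℕ → ℕ := fun n => τ (runH σ τ n ++ [σ (runH σ τ n)])
  have hH : ∀ n, histM M B n = runH σ τ n := by
    intro n
    induction n with
    | zero => rfl
    | succ n ih => simp [histM, runH, ih, M, B]
  have h1 : FollowsMaker σ M B := fun n => by rw [hH]
  have h2 : FollowsBreaker τ M B := fun n => by rw [histB, hH]
  refine ⟨M, B, ?_, h1, h2⟩
  have key : ∀ i j, i < j → (if i % 2 = 0 then M (i / 2) else B (i / 2)) ≠
      (if j % 2 = 0 then M (j / 2) else B (j / 2)) := by
    intro i j hij he
    by_cases hj : j % 2 = 0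
    · have hm := mem_histM M B (j / 2) i (by omega)
      rw [he, if_pos hj, h1 (j / 2)] at hm
      exact hσ _ hm
    · have hm : (if i % 2 = 0 then M (i / 2) else B (i / 2)) ∈ histB M B (j / 2) := by
        rw [histB, List.mem_append]
        by_cases hi : i < 2 * (j / 2)
        · exact Or.inl (mem_histM M B (j / 2) i hi)
        · right
          have e1 : i % 2 = 0 := by omega
          have e2 : i / 2 = j / 2 := by omega
          rw [if_pos e1, e2]; simp
      rw [he, if_neg hj, h2 (j / 2)] at hm
      exact hτ _ hm
  intro i j hij
  rcases lt_trichotomy i j with h | h | h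
  · exact (key i j h hij).elim
  · exact h
  · exact (key j i h hij.symm).elim

lemma exists_target (A : ℕ → Set ℕ) (hA : ∀ n, (A n).Infinite) :
    ∃ σ : List ℕ → ℕ, ValidStrat σ ∧ ∀ h, σ h ∈ A (h.length / 2) := by
  have : ∀ h : List ℕ, ∃ x, x ∉ h ∧ x ∈ A (h.length / 2) := by
    intro h
    obtain ⟨x, hx, hx'⟩ := (hA (h.length / 2)).exists_notMem_finset h.toFinset
    exact ⟨x, by simpa using hx', hx⟩
  choose σ h1 h2 using this
  exact ⟨σ, h1, h2⟩

lemma IsPlay.injM {M B : ℕ → ℕ} (h : IsPlay M B) : Function.Injective M := by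
  intro i j hij
  have := @h (2 * i) (2 * j) (by simpa using hij)
  omega

lemma IsPlay.injB {M B : ℕ → ℕ} (h : IsPlay M B) : Function.Injective B := by
  intro i j hij
  have := @h (2 * i + 1) (2 * j + 1) (by
    have e1 : (2 * i + 1) / 2 = i := by omega
    have e2 : (2 * j + 1) / 2 = j := by omega
    have e3 : (2 * i + 1) % 2 ≠ 0 := by omega
    have e4 : (2 * j + 1) % 2 ≠ 0 := by omega
    simpa only [e1, e2, if_neg e3, if_neg e4] using hij)
  omega

lemma IsPlay.ne {M B : ℕ → ℕ} (h : IsPlay M B) (i j : ℕ) : M i ≠ B j := by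
  intro hij
  have := @h (2 * i) (2 * j + 1) (by
    have e1 : (2 * i) / 2 = i := by omega
    have e2 : (2 * j + 1) / 2 = j := by omega
    have e3 : (2 * i) % 2 = 0 := by omega
    have e4 : (2 * j + 1) % 2 ≠ 0 := by omega
    simpa only [e1, e2, if_pos e3, if_neg e4] using hij)
  omega

lemma enum_sets (𝒜 : Set (Set ℕ)) (hc : 𝒜.Countable) (hi : ∀ A ∈ 𝒜, A.Infinite) :
    ∃ A : ℕ → Set ℕ, (∀ n, (A n).Infinite) ∧ ∀ X ∈ 𝒜, ∃ n, A n = X := by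
  obtain ⟨A, hA⟩ := (hc.insert Set.univ).exists_eq_range (Set.insert_nonempty _ _)
  refine ⟨A, fun n => ?_, fun X hX => ?_⟩
  · have : A n ∈ insert Set.univ 𝒜 := hA ▸ Set.mem_range_self n
    rcases this with h | h
    · rw [h]; exact Set.infinite_univ
    · exact hi _ h
  · have : X ∈ Set.range A := hA ▸ Set.mem_insert_of_mem _ hX
    exact this

lemma stepW (τ : List ℕ → ℕ) (𝒜 : Set (Set ℕ)) (hc : 𝒜.Countable)
    (hi : ∀ A ∈ 𝒜, A.Infinite) :
    ∃ W : Set ℕ, W.Infinite ∧ (∀ A ∈ 𝒜, (W ∩ A).Nonempty) ∧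
      (ValidStrat τ → ∃ M B, IsPlay M B ∧ FollowsBreaker τ M B ∧ Set.range M = W) := by
  by_cases hτ : ValidStrat τ
  · obtain ⟨A, hA, hs⟩ := enum_sets 𝒜 hc hi
    obtain ⟨σ, hσ, hσA⟩ := exists_target A hA
    obtain ⟨M, B, hp, h1, h2⟩ := exists_play σ τ hσ hτ
    refine ⟨Set.range M, Set.infinite_range_of_injective hp.injM, ?_,
      fun _ => ⟨M, B, hp, h2, rfl⟩⟩
    intro X hX
    obtain ⟨n, rfl⟩ := hs X hX
    refine ⟨M n, ⟨n, rfl⟩, ?_⟩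
    have := hσA (histM M B n)
    rw [← h1 n, length_histM] at this
    have e : 2 * n / 2 = n := by omega
    rwa [e] at this
  · exact ⟨Set.univ, Set.infinite_univ, fun A hA => by simpa using (hi A hA).nonempty,
      fun h => (hτ h).elim⟩

lemma stepC (σ : List ℕ → ℕ) (𝒜 : Set (Set ℕ)) (hc : 𝒜.Countable)
    (hi : ∀ A ∈ 𝒜, A.Infinite) :
    ∃ C : Set ℕ, C.Infinite ∧ (∀ A ∈ 𝒜, (C ∩ A).Nonempty) ∧
      (ValidStrat σ → ∃ M B, IsPlay M B ∧ FollowsMaker σ M B ∧ Set.range B = C) := by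
  by_cases hσ : ValidStrat σ
  · obtain ⟨A, hA, hs⟩ := enum_sets 𝒜 hc hi
    obtain ⟨τ, hτ, hτA⟩ := exists_target A hA
    obtain ⟨M, B, hp, h1, h2⟩ := exists_play σ τ hσ hτ
    refine ⟨Set.range B, Set.infinite_range_of_injective hp.injB, ?_,
      fun _ => ⟨M, B, hp, h1, rfl⟩⟩
    intro X hX
    obtain ⟨n, rfl⟩ := hs X hX
    refine ⟨B n, ⟨n, rfl⟩, ?_⟩
    have := hτA (histB M B n)
    rw [← h2 n, histB, List.length_append, length_histM] at this
    have e : (2 * n + [M n].length) / 2 = n := by simp; omega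
    rwa [e] at this
  · exact ⟨Set.univ, Set.infinite_univ, fun A hA => by simpa using (hi A hA).nonempty,
      fun h => (hσ h).elim⟩

/-- The requirement on the pair of sets chosen for the strategy `s`, given the earlier pairs. -/
def GoodPair (s : List ℕ → ℕ) (P : Set (Set ℕ × Set ℕ)) (q : Set ℕ × Set ℕ) : Prop :=
  (q.1.Infinite ∧ q.2.Infinite) ∧
  (∀ p ∈ P, (q.1 ∩ p.2).Nonempty) ∧ (∀ p ∈ P, (q.2 ∩ p.1).Nonempty) ∧ (q.2 ∩ q.1).Nonempty ∧
  (ValidStrat s → ∃ M B, IsPlay M B ∧ FollowsBreaker s M B ∧ Set.range M = q.1) ∧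
  (ValidStrat s → ∃ M B, IsPlay M B ∧ FollowsMaker s M B ∧ Set.range B = q.2)

lemma exists_goodPair (s : List ℕ → ℕ) (P : Set (Set ℕ × Set ℕ)) (hc : P.Countable)
    (hi : ∀ p ∈ P, p.1.Infinite ∧ p.2.Infinite) : ∃ q, GoodPair s P q := by
  obtain ⟨W, hW, hWA, hWs⟩ := stepW s (Prod.snd '' P) (hc.image _) (by
    rintro _ ⟨p, hp, rfl⟩; exact (hi p hp).2)
  obtain ⟨C, hC, hCA, hCs⟩ := stepC s (insert W (Prod.fst '' P)) ((hc.image _).insert _) (by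
    rintro _ (rfl | ⟨p, hp, rfl⟩)
    · exact hW
    · exact (hi p hp).1)
  exact ⟨(W, C), ⟨hW, hC⟩, fun p hp => hWA _ ⟨p, hp, rfl⟩,
    fun p hp => hCA _ (Or.inr ⟨p, hp, rfl⟩), hCA _ (Or.inl rfl), hWs, hCs⟩

lemma exists_family (hCH : Cardinal.continuum = Cardinal.aleph 1) :
    ∃ W C : (List ℕ → ℕ) → Set ℕ, (∀ s t, (W s ∩ C t).Nonempty) ∧
      ∀ s, ValidStrat s →
        (∃ M B, IsPlay M B ∧ FollowsBreaker s M B ∧ Set.range M = W s) ∧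
        (∃ M B, IsPlay M B ∧ FollowsMaker s M B ∧ Set.range B = C s) := by
  classical
  obtain ⟨r, hwo, hr⟩ := Cardinal.exists_ord_eq (List ℕ → ℕ)
  have hcard : Cardinal.mk (List ℕ → ℕ) = Cardinal.aleph 1 := by
    have h0 : Cardinal.continuum.{0} = Cardinal.aleph 1 := by
      apply Cardinal.lift_injective
      rw [Cardinal.lift_continuum, Cardinal.lift_aleph]
      simpa using hCH
    rw [← h0]; simp
  have hcount : ∀ x, {y | r y x}.Countable := by
    intro x
    have := Cardinal.card_typein_lt x hr
    rw [hcard, Ordinal.card_typein] at this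
    rw [← Cardinal.le_aleph0_iff_set_countable]
    rw [← Order.lt_succ_iff, Cardinal.succ_aleph0]
    exact this
  have hwf : WellFounded r := hwo.wf
  let f : (List ℕ → ℕ) → Set ℕ × Set ℕ := hwf.fix (fun x g =>
    if h : ∃ q, GoodPair x {p | ∃ y, ∃ hy : r y x, g y hy = p} q then h.choose else (∅, ∅))
  have hf : ∀ x, GoodPair x (f '' {y | r y x}) (f x) := by
    intro x
    induction x using hwf.induction with
    | _ x ih =>
      have hex : ∃ q, GoodPair x (f '' {y | r y x}) q := by
        apply exists_goodPair _ _ ((hcount x).image f)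
        rintro _ ⟨y, hy, rfl⟩
        exact (ih y hy).1
      have hset : {p | ∃ y, ∃ _ : r y x, f y = p} = f '' {y | r y x} := by
        ext p; simp
      have hfx : f x = if h : ∃ q, GoodPair x {p | ∃ y, ∃ _ : r y x, f y = p} q
          then h.choose else (∅, ∅) := hwf.fix_eq _ x
      rw [← hset] at hex ⊢
      rw [hfx, dif_pos hex]
      exact hex.choose_spec
  refine ⟨fun s => (f s).1, fun s => (f s).2, fun s t => ?_, fun s hs =>
    ⟨(hf s).2.2.2.2.1 hs, (hf s).2.2.2.2.2 hs⟩⟩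
  rcases trichotomous_of r s t with h | h | h
  · rw [Set.inter_comm]; exact (hf t).2.2.1 _ ⟨s, h, rfl⟩
  · subst h; rw [Set.inter_comm]; exact (hf s).2.2.2.1
  · exact (hf s).2.1 _ ⟨t, h, rfl⟩

/-- Assuming the continuum hypothesis, there is an undetermined Maker-Breaker
game on the countably infinite board ℕ: neither Maker nor Breaker has a
winning strategy. -/
theorem undetermined_maker_breaker_game
    (hCH : Cardinal.continuum = Cardinal.aleph 1) :
    ∃ 𝒲 : Set (Set ℕ),
      (¬ ∃ σ : List ℕ → ℕ, ValidStrat σ ∧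
        ∀ M B : ℕ → ℕ, IsPlay M B → FollowsMaker σ M B →
          ∃ W ∈ 𝒲, W ⊆ Set.range M) ∧
      (¬ ∃ τ : List ℕ → ℕ, ValidStrat τ ∧
        ∀ M B : ℕ → ℕ, IsPlay M B → FollowsBreaker τ M B →
          ∀ W ∈ 𝒲, ¬ W ⊆ Set.range M) := by
  obtain ⟨W, C, hWC, hs⟩ := exists_family hCH
  refine ⟨Set.range W, ?_, ?_⟩
  · rintro ⟨σ, hσ, hwin⟩
    obtain ⟨M, B, hp, hf, hB⟩ := (hs σ hσ).2
    obtain ⟨_, ⟨t, rfl⟩, hsub⟩ := hwin M B hp hf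
    obtain ⟨x, hx1, hx2⟩ := hWC t σ
    obtain ⟨i, hi⟩ := hsub hx1
    rw [← hB] at hx2
    obtain ⟨j, hj⟩ := hx2
    exact hp.ne i j (hi.trans hj.symm)
  · rintro ⟨τ, hτ, hwin⟩
    obtain ⟨M, B, hp, hf, hM⟩ := (hs τ hτ).1
    exact hwin M B hp hf (W τ) ⟨τ, rfl⟩ hM.ge
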